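/- There is no isometric embedding of the lattice ⟨−8⟩ ⊕ U(2) ⊕ U(2) into U ⊕ U ⊕ U whose image is a primitive sublattice. -/

import Mathlib

open Finset

/-- The underlying `ℤ`-module of `⟨-8⟩ ⊕ U(2) ⊕ U(2)`. -/
abbrev TT : Type := ℤ × (Fin 2 → Fin 2 → ℤ)

/-- The bilinear form of `⟨-8⟩ ⊕ U(2) ⊕ U(2)`: `⟨-8⟩` is `ℤ` with `b(x,y) = -8xy`,
and each `U(2)` has Gram matrix `[[0,2],[2,0]]`. -/
def bT (x y : TT) : ℤ :=
  -8 * x.1 * y.1 + ∑ i : Fin 2, (2 * (x.2 i 0 * y.2 i 1) + 2 * (x.2 i 1 * y.2 i 0))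

/-- The underlying `ℤ`-module of `U ⊕ U ⊕ U`. -/
abbrev U3T : Type := Fin 3 → Fin 2 → ℤ

/-- The bilinear form of `U ⊕ U ⊕ U`: each `U` has Gram matrix `[[0,1],[1,0]]`. -/
def bU3 (x y : U3T) : ℤ := ∑ i : Fin 3, (x i 0 * y i 1 + x i 1 * y i 0)

/-- Reduction modulo 2 of the images under `j` of the standard basis of `U(2) ⊕ U(2)`,
written as the rows of a matrix. -/
def mapModTwo (j : TT →ₗ[ℤ] U3T) : Matrix (Fin 2 × Fin 2) (Fin 3 × Fin 2) (ZMod 2) :=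
  fun i r => (j (0, Pi.single i.1 (Pi.single i.2 1)) r.1 r.2 : ZMod 2)

lemma map_eq_sum_single (j : TT →ₗ[ℤ] U3T) (c : Fin 2 × Fin 2 → ℤ) :
    j (0, fun a b => c (a, b)) = ∑ i, c i • j (0, Pi.single i.1 (Pi.single i.2 1)) := by
  simp_rw [← map_smul]
  rw [← map_sum]
  congr 1
  ext a b
  · simp [Fintype.sum_prod_type]
  · fin_cases a <;> fin_cases b <;> simp [Fintype.sum_prod_type]

/-- A primitive embedding stays injective modulo 2. -/
lemma linearIndependent_mapModTwo {j : TT →ₗ[ℤ] U3T} (hj : Function.Injective j)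
    (hprim : ∀ (p : U3T) (n : ℤ), n ≠ 0 → n • p ∈ LinearMap.range j → p ∈ LinearMap.range j) :
    LinearIndependent (ZMod 2) (mapModTwo j).row := by
  rw [Fintype.linearIndependent_iff]
  intro g hg
  choose c hc using fun i => ZMod.intCast_surjective (g i)
  have hdvd (r : Fin 3) (s : Fin 2) : (2 : ℤ) ∣ j (0, fun a b => c (a, b)) r s := by
    rw [← Nat.cast_ofNat, ← ZMod.intCast_zmod_eq_zero_iff_dvd, map_eq_sum_single]
    simpa [← hc, mapModTwo, Matrix.row] using congrFun hg (r, s)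
  choose p hp using hdvd
  have hp' : j (0, fun a b => c (a, b)) = (2 : ℤ) • (p : U3T) := by
    ext r s
    simpa using hp r s
  obtain ⟨t, ht⟩ := hprim p 2 two_ne_zero ⟨_, hp'⟩
  rw [← ht, ← map_smul] at hp'
  have ht' := hj hp'
  rintro ⟨a, b⟩
  have h := congrFun (congrFun (congrArg Prod.snd ht') a) b
  rw [← hc, ZMod.intCast_zmod_eq_zero_iff_dvd]
  exact ⟨t.2 a b, by simpa using h⟩

/-- The rows of `mapModTwo j` span a totally isotropic subspace of `U ⊕ U ⊕ U` modulo 2. -/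
lemma mapModTwo_mul_swap {j : TT →ₗ[ℤ] U3T} (hb : ∀ x y : TT, bU3 (j x) (j y) = bT x y) :
    mapModTwo j *
      ((mapModTwo j).submatrix id ((Equiv.refl (Fin 3)).prodCongr (Equiv.swap 0 1))).transpose
        = 0 := by
  ext i k
  have h := congrArg (Int.cast : ℤ → ZMod 2)
    (hb (0, Pi.single i.1 (Pi.single i.2 1)) (0, Pi.single k.1 (Pi.single k.2 1)))
  have h2 : (2 : ZMod 2) = 0 := rfl
  simp only [bU3, bT] at h
  push_cast at h
  simpa [Matrix.mul_apply, Fintype.sum_prod_type, mapModTwo, h2] using h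

/-- there is no isometric embedding of `⟨-8⟩ ⊕ U(2) ⊕ U(2)` into
`U ⊕ U ⊕ U` whose image is a primitive sublattice. -/
theorem no_primitive_embedding_TY_in_U3 :
    ¬ ∃ j : TT →ₗ[ℤ] U3T,
      Function.Injective j ∧
      (∀ x y : TT, bU3 (j x) (j y) = bT x y) ∧
      (∀ (p : U3T) (n : ℤ), n ≠ 0 → n • p ∈ LinearMap.range j → p ∈ LinearMap.range j) := by
  rintro ⟨j, hj, hb, hprim⟩
  have hrank := (linearIndependent_mapModTwo hj hprim).rank_matrix
  have hle := Matrix.rank_add_rank_le_card_of_mul_eq_zero (mapModTwo_mul_swap hb)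
  rw [Matrix.rank_transpose, ← Equiv.coe_refl, Matrix.rank_submatrix, hrank] at hle
  simp at hle
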